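/- arXiv:2412.09968 — 3 statements merged into one kernel-verified Lean document; each statement's English description precedes it below -/
import Mathlib

section
/- Let d ≥ 0 and let G₁ = (V₁, E₁) and G₂ = (V₂, E₂) be finite simple graphs in which every vertex has degree exactly d. Fix a representation type X, a constant c ∈ X, and update functions f_ℓ : X × Multiset X → X for ℓ = 1,…,n. Run on both graphs the MPGNN with constant initial representation h⁰(v) = c for all vertices. Then for every layer ℓ ∈ {0,…,n}, all vertices u ∈ V₁ and v ∈ V₂ satisfy h^ℓ(u) = h^ℓ(v); in particular, within each graph all vertices share the same representation at every layer. -/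
/-- A message-passing GNN: `mpgnn G h0 f ℓ v` is the layer-`ℓ` representation `h^ℓ(v)`,
with initial representation `h0` and update functions `f ℓ`, where layer `ℓ ≥ 1` applies
`f ℓ` to the previous representation of `v` and the multiset of previous representations
of the neighbors of `v`. -/
def mpgnn {V X : Type*} [Fintype V] (G : SimpleGraph V) [DecidableRel G.Adj]
    (h0 : V → X) (f : ℕ → X × Multiset X → X) : ℕ → V → X
  | 0 => h0
  | ℓ + 1 => fun v =>
      f (ℓ + 1) (mpgnn G h0 f ℓ v, (G.neighborFinset v).val.map (mpgnn G h0 f ℓ))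

/-- The common layer-`ℓ` representation of the vertices of a `d`-regular graph under an MPGNN
with constant initial representation `c`. -/
def regularRepr {X : Type*} (d : ℕ) (c : X) (f : ℕ → X × Multiset X → X) : ℕ → X
  | 0 => c
  | ℓ + 1 => f (ℓ + 1) (regularRepr d c f ℓ, Multiset.replicate d (regularRepr d c f ℓ))

theorem mpgnn_const_eq_regularRepr {V X : Type*} [Fintype V] (G : SimpleGraph V)
    [DecidableRel G.Adj] {d : ℕ} (hreg : G.IsRegularOfDegree d) (c : X)
    (f : ℕ → X × Multiset X → X) (ℓ : ℕ) :
    mpgnn G (fun _ => c) f ℓ = fun _ => regularRepr d c f ℓ := by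
  induction ℓ with
  | zero => rfl
  | succ ℓ ih =>
    funext v
    have hcard : (G.neighborFinset v).val.card = d := hreg v
    simp only [mpgnn, regularRepr, ih, Multiset.map_const', hcard]

/-- On `d`-regular graphs, an MPGNN with constant initial representation `c`
assigns all vertices (even across the two graphs) the same representation at every layer
`ℓ ∈ {0,…,n}`. -/
theorem mpgnn_const_on_regular {V₁ V₂ X : Type*} [Fintype V₁] [Fintype V₂]
    (G₁ : SimpleGraph V₁) (G₂ : SimpleGraph V₂) [DecidableRel G₁.Adj] [DecidableRel G₂.Adj]
    (d : ℕ) (hreg₁ : G₁.IsRegularOfDegree d) (hreg₂ : G₂.IsRegularOfDegree d)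
    (c : X) (n : ℕ) (f : ℕ → X × Multiset X → X) :
    ∀ ℓ ≤ n, ∀ (u : V₁) (v : V₂),
      mpgnn G₁ (fun _ => c) f ℓ u = mpgnn G₂ (fun _ => c) f ℓ v := by
  intro ℓ _ u v
  rw [mpgnn_const_eq_regularRepr G₁ hreg₁, mpgnn_const_eq_regularRepr G₂ hreg₂]
end

section
/- Let d ≥ 0 and let G₁ and G₂ be finite simple d-regular graphs with the same number of vertices. Run on both graphs an MPGNN with the same constant initial representation c ∈ X and the same update functions f₁,…,f_n. Then at every layer ℓ the multiset of node representations of G₁ equals the multiset of node representations of G₂, and consequently for every pooling function F on multisets of representations, the resulting graph representations of G₁ and G₂ coincide. -/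
/-- The representation shared by all nodes of a `d`-regular graph at each layer, when the initial
representation is the constant `c`. -/
def regularRep {X : Type*} (d : ℕ) (c : X) (f : ℕ → X × Multiset X → X) : ℕ → X
  | 0 => c
  | ℓ + 1 => f (ℓ + 1) (regularRep d c f ℓ, Multiset.replicate d (regularRep d c f ℓ))

theorem mpgnn_eq_regularRep {V X : Type*} [Fintype V] {G : SimpleGraph V} [DecidableRel G.Adj]
    {d : ℕ} (hreg : G.IsRegularOfDegree d) (c : X) (f : ℕ → X × Multiset X → X) (ℓ : ℕ) :
    mpgnn G (fun _ => c) f ℓ = fun _ => regularRep d c f ℓ := by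
  induction ℓ with
  | zero => rfl
  | succ ℓ ih =>
    funext v
    have hv : (G.neighborFinset v).card = d := hreg v
    simp only [mpgnn, regularRep, ih, Multiset.map_const', Finset.card_val, hv]

theorem map_mpgnn_univ_eq_replicate {V X : Type*} [Fintype V] {G : SimpleGraph V}
    [DecidableRel G.Adj] {d : ℕ} (hreg : G.IsRegularOfDegree d) (c : X)
    (f : ℕ → X × Multiset X → X) (ℓ : ℕ) :
    (Finset.univ : Finset V).val.map (mpgnn G (fun _ => c) f ℓ) =
      Multiset.replicate (Fintype.card V) (regularRep d c f ℓ) := by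
  rw [mpgnn_eq_regularRep hreg, Multiset.map_const', Finset.card_val, Finset.card_univ]

/-- Two `d`-regular graphs with the same number of vertices yield the same
multiset of node representations at every layer `ℓ ∈ {0,…,n}` under an MPGNN with constant
initial representation, and hence the same pooled graph representation for every pooling
function `F`. -/
theorem mpgnn_regular_same_card_indistinguishable {V₁ V₂ X : Type*} [Fintype V₁] [Fintype V₂]
    (G₁ : SimpleGraph V₁) (G₂ : SimpleGraph V₂) [DecidableRel G₁.Adj] [DecidableRel G₂.Adj]
    (d : ℕ) (hreg₁ : G₁.IsRegularOfDegree d) (hreg₂ : G₂.IsRegularOfDegree d)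
    (hcard : Fintype.card V₁ = Fintype.card V₂)
    (c : X) (n : ℕ) (f : ℕ → X × Multiset X → X) :
    (∀ ℓ ≤ n,
      (Finset.univ : Finset V₁).val.map (mpgnn G₁ (fun _ => c) f ℓ) =
        (Finset.univ : Finset V₂).val.map (mpgnn G₂ (fun _ => c) f ℓ)) ∧
    (∀ (Z : Type*) (F : Multiset X → Z),
      F ((Finset.univ : Finset V₁).val.map (mpgnn G₁ (fun _ => c) f n)) =
        F ((Finset.univ : Finset V₂).val.map (mpgnn G₂ (fun _ => c) f n))) := by
  have key (ℓ : ℕ) : (Finset.univ : Finset V₁).val.map (mpgnn G₁ (fun _ => c) f ℓ) =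
      (Finset.univ : Finset V₂).val.map (mpgnn G₂ (fun _ => c) f ℓ) := by
    rw [map_mpgnn_univ_eq_replicate hreg₁, map_mpgnn_univ_eq_replicate hreg₂, hcard]
  exact ⟨fun ℓ _ => key ℓ, fun _ F => congrArg F (key n)⟩
end

section
/- Augmenting constant node features with k-step random-walk positional encodings for any k ≥ 3 makes the graph pair C₆ and C₃ ⊔ C₃ distinguishable beyond the 1-WL test: set each vertex's initial representation to h⁰(v) = (c, p_v), where c is a fixed label encoding shared by all vertices of both graphs and p_v = ((RW¹)_{vv}, …, (RW^k)_{vv}) is its RWPE vector. Then for every choice of MPGNN update functions f₁,…,f_n and every injective function F on multisets of concatenated representations h(v) = (h⁰(v),…,hⁿ(v)), the resulting graph representations of C₆ and of C₃ ⊔ C₃ are different. -/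
open SimpleGraph

instance {α β : Type*} (G : SimpleGraph α) (H : SimpleGraph β)
    [DecidableRel G.Adj] [DecidableRel H.Adj] : DecidableRel (G ⊕g H).Adj
  | Sum.inl a, Sum.inl b => decidable_of_iff (G.Adj a b) (by simp)
  | Sum.inl _, Sum.inr _ => Decidable.isFalse (by simp)
  | Sum.inr _, Sum.inl _ => Decidable.isFalse (by simp)
  | Sum.inr a, Sum.inr b => decidable_of_iff (H.Adj a b) (by simp)

/-- The random-walk matrix `RW = A D⁻¹` of a finite simple graph over `ℚ`. -/
noncomputable def rwMatrix {V : Type*} [Fintype V] [DecidableEq V] (G : SimpleGraph V)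
    [DecidableRel G.Adj] : Matrix V V ℚ :=
  G.adjMatrix ℚ * (Matrix.diagonal fun v => (G.degree v : ℚ))⁻¹

/-- The `k`-step random-walk positional encoding of vertex `v`:
`p_v = ((RW¹)_{vv}, …, (RW^k)_{vv})`. -/
noncomputable def rwpe {V : Type*} [Fintype V] [DecidableEq V] (G : SimpleGraph V)
    [DecidableRel G.Adj] (k : ℕ) (v : V) : Fin k → ℚ :=
  fun i => (rwMatrix G ^ (i.val + 1)) v v

/-- On a `d`-regular graph the random-walk matrix is the adjacency matrix divided by `d`. -/
theorem rwMatrix_of_isRegularOfDegree {V : Type*} [Fintype V] [DecidableEq V]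
    (G : SimpleGraph V) [DecidableRel G.Adj] {d : ℕ} (hd : G.IsRegularOfDegree d) :
    rwMatrix G = (d : ℚ)⁻¹ • G.adjMatrix ℚ := by
  have hdeg : (fun v => (G.degree v : ℚ)) = fun _ => (d : ℚ) := by
    funext v
    rw [hd v]
  have hinv : Ring.inverse (fun _ : V => (d : ℚ)) = fun _ => (d : ℚ)⁻¹ := by
    rcases isEmpty_or_nonempty V with hV | hV
    · exact Subsingleton.elim _ _
    · by_cases h : (d : ℚ) = 0
      · rw [Ring.inverse_non_unit _ (by simp [Pi.isUnit_iff, h])]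
        funext v
        simp [h]
      · have hunit : IsUnit (fun _ : V => (d : ℚ)) := by simp [Pi.isUnit_iff, h]
        funext v
        exact eq_inv_of_mul_eq_one_left (congrFun (Ring.inverse_mul_cancel _ hunit) v)
  ext u v
  rw [rwMatrix, hdeg, Matrix.inv_diagonal, hinv, Matrix.mul_diagonal, Matrix.smul_apply,
    smul_eq_mul, mul_comm]

/-- On a `d`-regular graph the return probabilities are normalized closed-walk counts. -/
theorem rwpe_of_isRegularOfDegree {V : Type*} [Fintype V] [DecidableEq V]
    (G : SimpleGraph V) [DecidableRel G.Adj] {d : ℕ} (hd : G.IsRegularOfDegree d)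
    (k : ℕ) (v : V) (i : Fin k) :
    rwpe G k v i = ((d : ℚ)⁻¹) ^ (i.val + 1) * ((G.adjMatrix ℕ ^ (i.val + 1)) v v : ℕ) := by
  have hcast : G.adjMatrix ℚ = (Nat.castRingHom ℚ).mapMatrix (G.adjMatrix ℕ) := by
    ext u w
    simp [adjMatrix_apply]
  rw [rwpe, rwMatrix_of_isRegularOfDegree G hd, smul_pow, Matrix.smul_apply, hcast, ← map_pow]
  simp

theorem rwpe_cycleGraph_six_three_steps {k : ℕ} (hk : 2 < k) (v : Fin 6) :
    rwpe (cycleGraph 6) k v ⟨2, hk⟩ = 0 := by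
  have hd : (cycleGraph 6).IsRegularOfDegree 2 := fun v => by revert v; decide
  have h : ((cycleGraph 6).adjMatrix ℕ ^ (2 + 1)) v v = 0 := by
    rw [pow_succ, pow_two]
    revert v
    decide
  rw [rwpe_of_isRegularOfDegree _ hd, h]
  simp

theorem rwpe_two_triangles_three_steps {k : ℕ} (hk : 2 < k) :
    rwpe (cycleGraph 3 ⊕g cycleGraph 3) k (Sum.inl 0) ⟨2, hk⟩ = 1 / 4 := by
  have hd : @IsRegularOfDegree _ (cycleGraph 3 ⊕g cycleGraph 3)
      (fun v => Subtype.fintype (· ∈ neighborSet _ v)) 2 := fun v => by revert v; decide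
  have h : ((cycleGraph 3 ⊕g cycleGraph 3).adjMatrix ℕ ^ (2 + 1)) (Sum.inl 0) (Sum.inl 0) = 2 := by
    rw [pow_succ, pow_two]
    decide
  rw [rwpe_of_isRegularOfDegree _ hd, h]
  norm_num

/-- Augmenting a constant label encoding `c` with `k`-step RWPE (`k ≥ 3`)
as initial representation `h⁰(v) = (c, p_v)` makes `C₆` and `C₃ ⊔ C₃` distinguishable: for
every choice of update functions `f` and every injective readout `F` on multisets of
concatenated representations `h(v) = (h⁰(v), …, hⁿ(v))`, the two graph representations
differ. -/
theorem rwpe_mpgnn_distinguishes_cycle_six_from_two_triangles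
    {M Z : Type*} (c : M) (k : ℕ) (hk : 3 ≤ k) (n : ℕ)
    (f : ℕ → (M × (Fin k → ℚ)) × Multiset (M × (Fin k → ℚ)) → M × (Fin k → ℚ))
    (F : Multiset (Fin (n + 1) → M × (Fin k → ℚ)) → Z) (hF : Function.Injective F) :
    F ((Finset.univ : Finset (Fin 6)).val.map
        (fun v => fun ℓ : Fin (n + 1) =>
          mpgnn (cycleGraph 6) (fun u => (c, rwpe (cycleGraph 6) k u)) f ℓ.val v)) ≠
      F ((Finset.univ : Finset (Fin 3 ⊕ Fin 3)).val.map
        (fun v => fun ℓ : Fin (n + 1) =>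
          mpgnn (cycleGraph 3 ⊕g cycleGraph 3)
            (fun u => (c, rwpe (cycleGraph 3 ⊕g cycleGraph 3) k u)) f ℓ.val v)) := by
  intro h
  have hmem := Multiset.mem_map_of_mem (fun v => fun ℓ : Fin (n + 1) =>
    mpgnn (cycleGraph 3 ⊕g cycleGraph 3)
      (fun u => (c, rwpe (cycleGraph 3 ⊕g cycleGraph 3) k u)) f ℓ.val v)
    (Finset.mem_univ_val (Sum.inl 0 : Fin 3 ⊕ Fin 3))
  rw [← hF h] at hmem
  obtain ⟨v, -, hv⟩ := Multiset.mem_map.mp hmem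
  have hinit : rwpe (cycleGraph 6) k v =
      rwpe (cycleGraph 3 ⊕g cycleGraph 3) k (Sum.inl 0) :=
    congrArg Prod.snd (congrFun hv 0)
  have hthree := congrFun hinit ⟨2, hk⟩
  rw [rwpe_cycleGraph_six_three_steps, rwpe_two_triangles_three_steps] at hthree
  norm_num at hthree
end
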